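/- There exists a universal constant c > 0 such that for every finite set P ⊆ ℤ × ℤ and every independent family R of unsatisfied rectangles of P, every finite arborally satisfied superset Q of P satisfies |Q| ≥ |P| + c · |R|. (This is the independent rectangle lower bound: OPT(X) = Ω(IRB(G_X)).) -/

import Mathlib

/-- `c` lies in the closed rectangle spanned by `a` and `b`. -/
def InRect (a b c : ℤ × ℤ) : Prop :=
  min a.1 b.1 ≤ c.1 ∧ c.1 ≤ max a.1 b.1 ∧ min a.2 b.2 ≤ c.2 ∧ c.2 ≤ max a.2 b.2

/-- The pair `a, b` is arborally satisfied in `P`. -/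
def PairSat (P : Set (ℤ × ℤ)) (a b : ℤ × ℤ) : Prop :=
  ∃ c ∈ P, c ≠ a ∧ c ≠ b ∧ InRect a b c

/-- `P` is an arborally satisfied set. -/
def ArborallySatisfied (P : Set (ℤ × ℤ)) : Prop :=
  ∀ a ∈ P, ∀ b ∈ P, a.1 ≠ b.1 → a.2 ≠ b.2 → PairSat P a b

/-- A rectangle is an (unordered) pair of points, represented as an ordered pair
normalized so that the first point has the smaller `y`-coordinate.
`UnsatFamily P R` says every member of `R` is an unsatisfied rectangle of `P`. -/
def UnsatFamily (P : Finset (ℤ × ℤ)) (R : Finset ((ℤ × ℤ) × (ℤ × ℤ))) : Prop :=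
  ∀ r ∈ R, r.1 ∈ P ∧ r.2 ∈ P ∧ r.1.2 < r.2.2 ∧ r.1.1 ≠ r.2.1 ∧
    ¬ PairSat (↑P : Set (ℤ × ℤ)) r.1 r.2

/-- `p` is a corner of the rectangle `r`. -/
def RectCorner (r : (ℤ × ℤ) × (ℤ × ℤ)) (p : ℤ × ℤ) : Prop :=
  (p.1 = r.1.1 ∨ p.1 = r.2.1) ∧ (p.2 = r.1.2 ∨ p.2 = r.2.2)

/-- `p` lies strictly inside the rectangle `r`. -/
def StrictInside (r : (ℤ × ℤ) × (ℤ × ℤ)) (p : ℤ × ℤ) : Prop :=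
  min r.1.1 r.2.1 < p.1 ∧ p.1 < max r.1.1 r.2.1 ∧
  min r.1.2 r.2.2 < p.2 ∧ p.2 < max r.1.2 r.2.2

/-- A family of rectangles is independent if no corner of one member lies
strictly inside another member. -/
def IndepFamily (R : Finset ((ℤ × ℤ) × (ℤ × ℤ))) : Prop :=
  ∀ r ∈ R, ∀ s ∈ R, r ≠ s → ∀ p : ℤ × ℤ, RectCorner r p → ¬ StrictInside s p


lemma exists_pq (Q : Finset (ℤ × ℤ)) (hQ : ArborallySatisfied (↑Q : Set (ℤ × ℤ)))
    (a b : ℤ × ℤ) (ha : a ∈ Q) (hb : b ∈ Q) (w : ℤ) (h1 : a.1 ≤ w) (h2 : w < b.1)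
    (h3 : a.2 < b.2) :
    ∃ p ∈ Q, ∃ q ∈ Q, p.2 = q.2 ∧ a.1 ≤ p.1 ∧ p.1 ≤ w ∧ w < q.1 ∧ q.1 ≤ b.1 ∧ a.2 ≤ p.2 ∧
      p.2 ≤ b.2 ∧ ∀ c ∈ Q, c.2 = p.2 → p.1 < c.1 → q.1 ≤ c.1 := by
  classical
  obtain ⟨p, hp, hpm⟩ := Finset.exists_max_image
    (Q.filter fun c => a.1 ≤ c.1 ∧ c.1 ≤ w ∧ a.2 ≤ c.2 ∧ c.2 ≤ b.2)
    (fun c => toLex (c.2, c.1)) ⟨a, by simp only [Finset.mem_filter]; exact ⟨ha, by omega⟩⟩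
  simp only [Finset.mem_filter, Prod.Lex.toLex_le_toLex] at hp hpm
  obtain ⟨q, hq, hqm⟩ := Finset.exists_min_image
    (Q.filter fun c => w < c.1 ∧ c.1 ≤ b.1 ∧ p.2 ≤ c.2 ∧ c.2 ≤ b.2)
    (fun c => toLex (c.2, c.1)) ⟨b, by simp only [Finset.mem_filter]; exact ⟨hb, by omega⟩⟩
  simp only [Finset.mem_filter, Prod.Lex.toLex_le_toLex] at hq hqm
  have hpq : p.2 = q.2 := by
    by_contra hne
    obtain ⟨c, hc, hcp, hcq, hr⟩ := hQ p hp.1 q hq.1 (by omega) hne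
    have hc' : c ∈ Q := hc
    unfold InRect at hr
    rcases le_or_gt c.1 w with h | h
    · have := hpm c ⟨hc', by omega⟩
      exact hcp (Prod.ext (by omega) (by omega))
    · have := hqm c ⟨hc', by omega⟩
      exact hcq (Prod.ext (by omega) (by omega))
  refine ⟨p, hp.1, q, hq.1, hpq, by omega, by omega, by omega, by omega, by omega, by omega, ?_⟩
  intro c hc hc2 hc1
  by_contra hlt
  rcases le_or_gt c.1 w with h | h
  · have := hpm c ⟨hc, by omega⟩
    omega
  · have := hqm c ⟨hc, by omega⟩
    omega

/-- Arithmetic form of the hypotheses, for rectangles going up and right. -/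
def PlusFam (P : Finset (ℤ × ℤ)) (R : Finset ((ℤ × ℤ) × (ℤ × ℤ))) : Prop :=
  UnsatFamily P R ∧ IndepFamily R ∧ ∀ r ∈ R, r.1.1 < r.2.1

lemma PlusFam.out {P R} (h : PlusFam P R) {r s} (hr : r ∈ R) (hs : s ∈ R) (hne : r ≠ s) (u v : ℤ)
    (hu : u = r.1.1 ∨ u = r.2.1) (hv : v = r.1.2 ∨ v = r.2.2) :
    ¬ (s.1.1 < u ∧ u < s.2.1 ∧ s.1.2 < v ∧ v < s.2.2) := by
  intro h'
  apply h.2.1 r hr s hs hne (u, v) ⟨hu, hv⟩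
  unfold StrictInside
  dsimp only
  omega

lemma PlusFam.lt {P R} (h : PlusFam P R) {r} (hr : r ∈ R) :
    r.1 ∈ P ∧ r.2 ∈ P ∧ r.1.1 < r.2.1 ∧ r.1.2 < r.2.2 :=
  ⟨(h.1 r hr).1, (h.1 r hr).2.1, h.2.2 r hr, (h.1 r hr).2.2.1⟩

lemma PlusFam.pt {P R} (h : PlusFam P R) {r p} (hr : r ∈ R) (hp : p ∈ P)
    (h1 : r.1.1 ≤ p.1 ∧ p.1 ≤ r.2.1 ∧ r.1.2 ≤ p.2 ∧ p.2 ≤ r.2.2) :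
    (p.1 = r.1.1 ∧ p.2 = r.1.2) ∨ (p.1 = r.2.1 ∧ p.2 = r.2.2) := by
  by_contra hc
  push Not at hc
  refine (h.1 r hr).2.2.2.2 ⟨p, hp, ?_, ?_, ?_⟩
  · rintro rfl; simp at hc
  · rintro rfl; simp at hc
  · unfold InRect; omega

lemma PlusFam.partial {P R} (h : PlusFam P R) {r s} (hr : r ∈ R) (hs : s ∈ R)
    (h1 : r.1.1 < s.1.1) (h2 : s.1.1 < r.2.1) (h3 : r.2.1 < s.2.1)
    (h4 : r.1.2 < s.2.2) (h5 : s.1.2 < r.2.2) : False := by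
  have hne : r ≠ s := by rintro rfl; omega
  have e1 := h.out hs hr hne.symm s.1.1 s.1.2 (by simp) (by simp)
  have e2 := h.out hs hr hne.symm s.1.1 s.2.2 (by simp) (by simp)
  have e3 := h.out hr hs hne r.2.1 r.1.2 (by simp) (by simp)
  have e4 := h.out hr hs hne r.2.1 r.2.2 (by simp) (by simp)
  have l1 := h.lt hr
  have l2 := h.lt hs
  have := h.pt hr l2.1 (by omega)
  omega

lemma PlusFam.nested {P R} (h : PlusFam P R) {r s} (hr : r ∈ R) (hs : s ∈ R) (hne : r ≠ s)
    (hw : s.2.1 - s.1.1 ≤ r.2.1 - r.1.1)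
    (h1 : r.1.1 < s.2.1) (h2 : s.1.1 < r.2.1)
    (h4 : r.1.2 < s.2.2) (h5 : s.1.2 < r.2.2) :
    r.1.1 ≤ s.1.1 ∧ s.2.1 ≤ r.2.1 ∧ s.1.2 ≤ r.1.2 ∧ r.2.2 ≤ s.2.2 ∧
      (s.1.1 = r.1.1 → s.1 = r.1 ∧ s.2.1 < r.2.1) := by
  have l1 := h.lt hr
  have l2 := h.lt hs
  have a1 : r.1.1 ≤ s.1.1 := by
    by_contra hc
    exact h.partial hs hr (by omega) (by omega) (by omega) (by omega) (by omega)
  have a2 : s.2.1 ≤ r.2.1 := by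
    by_contra hc
    exact h.partial hr hs (by omega) (by omega) (by omega) (by omega) (by omega)
  have a3 : s.1.2 ≤ r.1.2 := by
    by_contra hc
    have := h.pt hr l2.1 (by omega)
    omega
  have a4 : r.2.2 ≤ s.2.2 := by
    by_contra hc
    have := h.pt hr l2.2.1 (by omega)
    omega
  refine ⟨a1, a2, a3, a4, fun he => ?_⟩
  have b1 := h.pt hs l1.1 (by omega)
  have b2 : s.1 = r.1 := Prod.ext he (by omega)
  refine ⟨b2, ?_⟩
  by_contra hc
  have b3 := h.pt hs l1.2.1 (by omega)
  exact hne (Prod.ext b2.symm (Prod.ext (by omega) (by omega)))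

/-- The dividing line of a rectangle. -/
def GoodLine (R : Finset ((ℤ × ℤ) × (ℤ × ℤ))) (r : (ℤ × ℤ) × (ℤ × ℤ)) (w : ℤ) : Prop :=
  r.1.1 ≤ w ∧ w < r.2.1 ∧ (∀ s ∈ R, s.1 = r.1 → s.2.1 < r.2.1 → s.2.1 ≤ w) ∧
    (w = r.1.1 ∨ ∃ s ∈ R, s.1 = r.1 ∧ s.2.1 = w)

lemma PlusFam.exists_line {P R} (h : PlusFam P R) {r} (hr : r ∈ R) : ∃ w, GoodLine R r w := by
  classical
  have l1 := h.lt hr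
  by_cases hne : (R.filter fun s => s.1 = r.1 ∧ s.2.1 < r.2.1).Nonempty
  · obtain ⟨s, hs, hm⟩ := Finset.exists_max_image _ (fun s => s.2.1) hne
    simp only [Finset.mem_filter] at hs hm
    have l2 := h.lt hs.1
    refine ⟨s.2.1, ?_, hs.2.2, fun t ht h1 h2 => hm t ⟨ht, h1, h2⟩, Or.inr ⟨s, hs.1, hs.2.1, rfl⟩⟩
    rw [← hs.2.1]; omega
  · refine ⟨r.1.1, le_rfl, by omega, fun t ht h1 h2 => ?_, Or.inl rfl⟩
    exact absurd ⟨t, by simp [ht, h1, h2]⟩ hne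

lemma PlusFam.line {P R} (h : PlusFam P R) {r s} (hr : r ∈ R) (hs : s ∈ R) (hne : r ≠ s)
    (hw : s.2.1 - s.1.1 ≤ r.2.1 - r.1.1)
    (h4 : r.1.2 < s.2.2) (h5 : s.1.2 < r.2.2) {w} (hg : GoodLine R r w)
    (h1 : s.1.1 ≤ w) (h2 : w < s.2.1) (h3 : s.1.1 < w ∨ w = r.1.1) : False := by
  obtain ⟨g1, g2, g3, g4⟩ := hg
  obtain ⟨n1, n2, n3, n4, n5⟩ := h.nested hr hs hne hw (by omega) (by omega) h4 h5
  by_cases he : s.1.1 = r.1.1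
  · obtain ⟨m1, m2⟩ := n5 he
    have := g3 s hs m1 m2
    omega
  · rcases g4 with g4 | ⟨t, ht, t1, t2⟩
    · omega
    · have l1 := h.lt hr
      have l3 := h.lt ht
      rw [t1] at l3
      exact h.partial ht hs (by rw [t1]; omega) (by omega) (by omega) (by rw [t1]; omega) (by omega)

/-- The charging relation. -/
def Charge (Q : Finset (ℤ × ℤ)) (R : Finset ((ℤ × ℤ) × (ℤ × ℤ))) (r : (ℤ × ℤ) × (ℤ × ℤ))
    (p q : ℤ × ℤ) : Prop :=
  p ∈ Q ∧ q ∈ Q ∧ p.2 = q.2 ∧ r.1.1 ≤ p.1 ∧ q.1 ≤ r.2.1 ∧ r.1.2 ≤ p.2 ∧ p.2 ≤ r.2.2 ∧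
    (∀ c ∈ Q, c.2 = p.2 → p.1 < c.1 → q.1 ≤ c.1) ∧
    ∃ w, GoodLine R r w ∧ p.1 ≤ w ∧ w < q.1

lemma PlusFam.inj_aux {P Q R} (h : PlusFam P R) {r s} (hr : r ∈ R) (hs : s ∈ R) {p q}
    (cr : Charge Q R r p q) (cs : Charge Q R s p q)
    (t1 : r.1.1 = p.1 ↔ s.1.1 = p.1) (t2 : r.1.2 = p.2 ↔ s.1.2 = p.2)
    (t3 : r.2.2 = p.2 ↔ s.2.2 = p.2) (hw : s.2.1 - s.1.1 ≤ r.2.1 - r.1.1) : r = s := by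
  by_contra hne
  obtain ⟨-, -, -, x1, x2, x3, x4, -, w, hg, x5, x6⟩ := cr
  obtain ⟨-, -, -, y1, y2, y3, y4, -, -⟩ := cs
  have l1 := h.lt hr
  have l2 := h.lt hs
  have g1 := hg.1
  exact h.line hr hs hne hw (by omega) (by omega) hg (by omega) (by omega) (by omega)

lemma PlusFam.inj {P Q R} (h : PlusFam P R) {r s} (hr : r ∈ R) (hs : s ∈ R) {p q}
    (cr : Charge Q R r p q) (cs : Charge Q R s p q)
    (t1 : r.1.1 = p.1 ↔ s.1.1 = p.1) (t2 : r.1.2 = p.2 ↔ s.1.2 = p.2)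
    (t3 : r.2.2 = p.2 ↔ s.2.2 = p.2) : r = s := by
  rcases le_total (s.2.1 - s.1.1) (r.2.1 - r.1.1) with hw | hw
  · exact h.inj_aux hr hs cr cs t1 t2 t3 hw
  · exact (h.inj_aux hs hr cs cr t1.symm t2.symm t3.symm hw).symm

lemma Charge.lt {Q R r p q} (c : Charge Q R r p q) : p.1 < q.1 := by
  obtain ⟨-, -, -, x1, x2, x3, x4, -, w, hg, x5, x6⟩ := c
  omega

lemma Charge.right {Q R r s p q q'} (c : Charge Q R r p q) (c' : Charge Q R s p q') : q = q' := by
  have h1 := c.2.2.2.2.2.2.2.1 q' c'.2.1 c'.2.2.1.symm c'.lt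
  have h2 := c'.2.2.2.2.2.2.2.1 q c.2.1 c.2.2.1.symm c.lt
  have := c.2.2.1
  have := c'.2.2.1
  exact Prod.ext (by omega) (by omega)

lemma Charge.left {Q R r s p p' q} (c : Charge Q R r p q) (c' : Charge Q R s p' q) : p = p' := by
  have e1 := c.2.2.1
  have e2 := c'.2.2.1
  have l1 := c.lt
  have l2 := c'.lt
  refine Prod.ext ?_ (by omega)
  rcases lt_trichotomy p.1 p'.1 with h | h | h
  · have := c.2.2.2.2.2.2.2.1 p' c'.1 (by omega) h
    omega
  · exact h
  · have := c'.2.2.2.2.2.2.2.1 p c.1 (by omega) h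
    omega

lemma plus_bound {P Q R} (h : PlusFam P R) (hPQ : P ⊆ Q)
    (hQ : ArborallySatisfied (↑Q : Set (ℤ × ℤ))) : R.card ≤ 16 * (Q \ P).card := by
  classical
  have key : ∀ r : (ℤ × ℤ) × (ℤ × ℤ), ∃ p q, r ∈ R → Charge Q R r p q := by
    intro r
    by_cases hr : r ∈ R
    · obtain ⟨w, hg⟩ := h.exists_line hr
      have l := h.lt hr
      obtain ⟨p, hp, q, hq, e1, e2, e3, e4, e5, e6, e7, e8⟩ :=
        exists_pq Q hQ r.1 r.2 (hPQ l.1) (hPQ l.2.1) w hg.1 hg.2.1 l.2.2.2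
      exact ⟨p, q, fun _ => ⟨hp, hq, e1, e2, e5, e6, e7, e8, w, hg, e3, e4⟩⟩
    · exact ⟨0, 0, fun h => absurd h hr⟩
  choose p q hc using key
  have hcard : ((Q \ P) ×ˢ (Finset.univ : Finset (Bool × Bool × Bool × Bool))).card
      = 16 * (Q \ P).card := by
    rw [Finset.card_product, mul_comm]; rfl
  rw [← hcard]
  apply Finset.card_le_card_of_injOn (fun r => (if p r ∈ P then q r else p r,
    decide (p r ∈ P), decide (r.1.1 = (p r).1), decide (r.1.2 = (p r).2),
    decide (r.2.2 = (p r).2)))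
  · intro r hr
    have hr : r ∈ R := hr
    have c := hc r hr
    have clt := c.lt
    obtain ⟨c1, c2, c3, c4, c5, c6, c7, -⟩ := c
    have l := h.lt hr
    simp only [Finset.coe_product, Set.mem_prod, Finset.mem_coe, Finset.mem_sdiff,
      Finset.mem_univ, and_true]
    split_ifs with hp
    · refine ⟨c2, fun hq => ?_⟩
      have := h.pt hr hp (by omega)
      have := h.pt hr hq (by omega)
      omega
    · exact ⟨c1, hp⟩
  · intro r hr s hs he
    have hr : r ∈ R := hr
    have hs : s ∈ R := hs
    have cr := hc r hr
    have cs := hc s hs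
    simp only [Prod.mk.injEq, decide_eq_decide] at he
    obtain ⟨f1, f2, f3, f4, f5⟩ := he
    have hpq : p r = p s := by
      by_cases hp : p r ∈ P
      · rw [if_pos hp, if_pos (f2.1 hp)] at f1
        rw [← f1] at cs
        exact cr.left cs
      · rw [if_neg hp, if_neg (fun h' => hp (f2.2 h'))] at f1
        exact f1
    rw [← hpq] at cs f3 f4 f5
    have hqq := cr.right cs
    rw [← hqq] at cs
    exact h.inj hr hs cr cs f3 f4 f5

/-- Reflection in the vertical axis. -/
def hflip (p : ℤ × ℤ) : ℤ × ℤ := (-p.1, p.2)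

lemma hflip_inj : Function.Injective hflip := by
  intro a b hab
  simp only [hflip, Prod.mk.injEq, neg_inj] at hab
  exact Prod.ext hab.1 hab.2

lemma inRect_hflip {a b c} : InRect (hflip a) (hflip b) (hflip c) ↔ InRect a b c := by
  unfold InRect hflip
  dsimp only
  omega

lemma pairSat_hflip {P : Finset (ℤ × ℤ)} {a b} :
    PairSat (↑(P.image hflip) : Set (ℤ × ℤ)) (hflip a) (hflip b) ↔ PairSat (↑P : Set (ℤ × ℤ)) a b := by
  unfold PairSat
  simp only [Finset.coe_image, Set.exists_mem_image, inRect_hflip, ne_eq, hflip_inj.eq_iff]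

lemma minus_bound {P Q R} (hu : UnsatFamily P R) (hi : IndepFamily R) (hlt : ∀ r ∈ R, r.2.1 < r.1.1)
    (hPQ : P ⊆ Q) (hQ : ArborallySatisfied (↑Q : Set (ℤ × ℤ))) : R.card ≤ 16 * (Q \ P).card := by
  classical
  have hinj : Function.Injective (Prod.map hflip hflip) := hflip_inj.prodMap hflip_inj
  rw [← Finset.card_image_of_injective R hinj, ← Finset.card_image_of_injective (Q \ P) hflip_inj,
    Finset.image_sdiff _ _ hflip_inj]
  refine plus_bound ⟨?_, ?_, ?_⟩ (Finset.image_subset_image hPQ) ?_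
  · intro r hr
    obtain ⟨r, hr', rfl⟩ := Finset.mem_image.1 hr
    obtain ⟨a1, a2, a3, a4, a5⟩ := hu r hr'
    refine ⟨Finset.mem_image_of_mem _ a1, Finset.mem_image_of_mem _ a2, a3, ?_, ?_⟩
    · simp only [Prod.map, hflip]; omega
    · simp only [Prod.map]; rwa [pairSat_hflip]
  · intro r hr s hs hne p
    obtain ⟨r, hr', rfl⟩ := Finset.mem_image.1 hr
    obtain ⟨s, hs', rfl⟩ := Finset.mem_image.1 hs
    have := hi r hr' s hs' (fun h => hne (by rw [h])) (hflip p)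
    simp only [RectCorner, StrictInside, Prod.map, hflip] at this ⊢
    omega
  · intro r hr
    obtain ⟨r, hr', rfl⟩ := Finset.mem_image.1 hr
    have := hlt r hr'
    simp only [Prod.map, hflip]; omega
  · intro a ha b hb h1 h2
    obtain ⟨a, ha', rfl⟩ := Finset.mem_image.1 (Finset.mem_coe.1 ha)
    obtain ⟨b, hb', rfl⟩ := Finset.mem_image.1 (Finset.mem_coe.1 hb)
    rw [pairSat_hflip]
    exact hQ a ha' b hb' (fun h => h1 (by simp [hflip, h])) h2

theorem independent_rectangle_lower_bound :
    ∃ c : ℝ, 0 < c ∧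
      ∀ (P : Finset (ℤ × ℤ)) (R : Finset ((ℤ × ℤ) × (ℤ × ℤ))),
        UnsatFamily P R → IndepFamily R →
        ∀ Q : Finset (ℤ × ℤ), P ⊆ Q → ArborallySatisfied (↑Q : Set (ℤ × ℤ)) →
          (P.card : ℝ) + c * R.card ≤ Q.card := by
  classical
  refine ⟨1 / 32, by norm_num, fun P R hu hi Q hPQ hQ => ?_⟩
  have h1 : (R.filter fun r => r.1.1 < r.2.1).card ≤ 16 * (Q \ P).card := by
    refine plus_bound ⟨fun r hr => hu r (Finset.mem_filter.1 hr).1, fun r hr s hs =>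
      hi r (Finset.mem_filter.1 hr).1 s (Finset.mem_filter.1 hs).1,
      fun r hr => (Finset.mem_filter.1 hr).2⟩ hPQ hQ
  have h2 : (R.filter fun r => ¬ r.1.1 < r.2.1).card ≤ 16 * (Q \ P).card := by
    refine minus_bound (fun r hr => hu r (Finset.mem_filter.1 hr).1) (fun r hr s hs =>
      hi r (Finset.mem_filter.1 hr).1 s (Finset.mem_filter.1 hs).1) (fun r hr => ?_) hPQ hQ
    have := (hu r (Finset.mem_filter.1 hr).1).2.2.2.1
    have := (Finset.mem_filter.1 hr).2
    omega
  have h3 := Finset.card_filter_add_card_filter_not (s := R) (fun r => r.1.1 < r.2.1)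
  have h4 := Finset.card_sdiff_add_card_eq_card hPQ
  have h5 : R.card + 32 * P.card ≤ 32 * Q.card := by omega
  have h6 : (R.card : ℝ) + 32 * P.card ≤ 32 * Q.card := by exact_mod_cast h5
  linarith
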